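/- arXiv:math/9704218 — 2 statements merged into one kernel-verified Lean document; each statement's English description precedes it below -/
import Mathlib

section
/- Let q : R^n → R be a positive semidefinite quadratic form with E(q) = 1 under the standard Gaussian measure μ on R^n. Then C_0 ≤ E(ln q) ≤ 0, where C_0 = (4/√(2π)) ∫_0^∞ (ln t) e^{-t²/2} dt. -/
open MeasureTheory ProbabilityTheory Matrix Real

open scoped MatrixOrder in
lemma psd_decomp {n : ℕ} (Q : Matrix (Fin n) (Fin n) ℝ) (hQ : Q.PosSemidef) :
    ∃ (c : Fin n → ℝ) (u : Fin n → Fin n → ℝ), (∀ i, 0 ≤ c i) ∧ (∀ i, ∑ j, u i j ^ 2 = 1) ∧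
      ∀ x : Fin n → ℝ, x ⬝ᵥ Q.mulVec x = ∑ i, c i * (∑ j, u i j * x j) ^ 2 := by
  obtain ⟨B, rfl⟩ := CStarAlgebra.nonneg_iff_eq_star_mul_self.mp hQ.nonneg
  have key : ∀ i : Fin n, ∃ (c : ℝ) (u : Fin n → ℝ), 0 ≤ c ∧ ∑ j, u j ^ 2 = 1 ∧
      ∀ j, B i j = √c * u j := by
    intro i
    have h0 : 0 ≤ ∑ j, B i j ^ 2 := Finset.sum_nonneg fun j _ => sq_nonneg _
    rcases h0.eq_or_lt with h | h
    · refine ⟨0, Pi.single i 1, le_rfl, ?_, ?_⟩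
      · simp [Pi.single_apply]
      · intro j
        have := (Finset.sum_eq_zero_iff_of_nonneg (fun j _ => sq_nonneg (B i j))).1 h.symm j
          (Finset.mem_univ j)
        simpa using this
    · refine ⟨∑ j, B i j ^ 2, fun j => B i j / √(∑ j, B i j ^ 2), h0, ?_, ?_⟩
      · simp_rw [div_pow, Real.sq_sqrt h0, ← Finset.sum_div]
        exact div_self h.ne'
      · intro j
        have := (Real.sqrt_pos.2 h).ne'
        field_simp
  choose c u hc hu hB using key
  refine ⟨c, u, hc, hu, fun x => ?_⟩
  have : x ⬝ᵥ (star B * B).mulVec x = (B *ᵥ x) ⬝ᵥ (B *ᵥ x) := by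
    rw [← Matrix.mulVec_mulVec, dotProduct_mulVec, star_eq_conjTranspose,
      conjTranspose_eq_transpose_of_trivial, vecMul_transpose]
  rw [this]
  simp only [dotProduct]
  refine Finset.sum_congr rfl fun i _ => ?_
  have h2 : (B *ᵥ x) i = √(c i) * ∑ j, u i j * x j := by
    simp only [mulVec, dotProduct, hB, Finset.mul_sum, mul_assoc]
  rw [h2]
  nlinarith [Real.mul_self_sqrt (hc i)]

lemma map_unit {n : ℕ} (u : Fin n → ℝ) (hu : ∑ j, u j ^ 2 = 1) :
    (Measure.pi fun _ : Fin n => gaussianReal 0 1).map (fun x => ∑ j, u j * x j)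
      = gaussianReal 0 1 := by
  have hm : Measurable (fun x : Fin n → ℝ => ∑ j, u j * x j) := by fun_prop
  have := Measure.isProbabilityMeasure_map
    (μ := Measure.pi fun _ : Fin n => gaussianReal 0 1) hm.aemeasurable
  apply Measure.ext_of_charFun
  ext t
  rw [charFun_gaussianReal, charFun_apply_real, integral_map hm.aemeasurable (by fun_prop)]
  have : ∀ x : Fin n → ℝ, Complex.exp (t * ((∑ j, u j * x j : ℝ) : ℂ) * Complex.I)
      = ∏ j, Complex.exp (((t * u j : ℝ) : ℂ) * x j * Complex.I) := by
    intro x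
    rw [← Complex.exp_sum]
    congr 1
    push_cast
    rw [Finset.mul_sum, Finset.sum_mul]
    exact Finset.sum_congr rfl fun j _ => by ring
  simp_rw [this]
  rw [integral_fintype_prod_eq_prod
    (f := fun j (x : ℝ) => Complex.exp (((t * u j : ℝ) : ℂ) * x * Complex.I))]
  simp_rw [← charFun_apply_real, charFun_gaussianReal]
  rw [← Complex.exp_sum]
  congr 1
  have h3 : ∑ j, ((u j : ℂ)) ^ 2 = 1 := by exact_mod_cast hu
  calc _ = ∑ j, (-(t:ℂ)^2/2) * (u j : ℂ)^2 := Finset.sum_congr rfl fun j _ => by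
            push_cast; ring
    _ = _ := by rw [← Finset.mul_sum, h3]; push_cast; ring

lemma integrable_log_gaussian :
    Integrable (fun t : ℝ => Real.log (t ^ 2)) (gaussianReal 0 1) := by
  have hsq : Integrable (fun t : ℝ => t ^ 2) (gaussianReal 0 1) :=
    (memLp_id_gaussianReal 2).integrable_sq
  have hind : Integrable (fun t : ℝ => (Set.Ioc (-1:ℝ) 1).indicator (fun t => Real.log t) t)
      (gaussianReal 0 1) := by
    rw [gaussianReal_of_var_ne_zero _ one_ne_zero,
      integrable_withDensity_iff_integrable_smul' (measurable_gaussianPDF _ _)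
      (ae_of_all _ fun _ ↦ gaussianPDF_lt_top)]
    have h1 : Integrable ((Set.Ioc (-1:ℝ) 1).indicator (fun t => Real.log t)) := by
      rw [integrable_indicator_iff measurableSet_Ioc]
      exact (intervalIntegral.intervalIntegrable_log' (a := -1) (b := 1)).1
    refine (h1.bdd_mul (c := (√(2 * π))⁻¹) (f := fun x => (gaussianPDF 0 1 x).toReal) ?_ ?_)
    · exact (measurable_gaussianPDF 0 1).ennreal_toReal.aestronglyMeasurable
    · refine ae_of_all _ fun x => ?_
      rw [toReal_gaussianPDF, Real.norm_of_nonneg (gaussianPDFReal_nonneg _ _ _), gaussianPDFReal]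
      simp only [NNReal.coe_one, mul_one]
      refine mul_le_of_le_one_right (by positivity) ?_
      rw [Real.exp_le_one_iff]
      have := sq_nonneg (x - 0)
      linarith
  refine ((hind.norm.const_mul 2).add hsq).mono' ?_ (ae_of_all _ fun t => ?_)
  · exact (Real.measurable_log.comp (measurable_id.pow_const 2)).aestronglyMeasurable
  · simp only [Pi.add_apply, Real.norm_eq_abs]
    by_cases ht : t ∈ Set.Ioc (-1:ℝ) 1
    · rw [Set.indicator_of_mem ht, Real.log_pow, abs_mul]
      have := sq_nonneg t
      simp only [Nat.cast_ofNat, Nat.abs_ofNat]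
      linarith
    · rw [Set.indicator_of_notMem ht]
      have h1 : 1 ≤ t ^ 2 := by
        simp only [Set.mem_Ioc, not_and_or, not_lt, not_le] at ht
        rcases ht with h | h <;> nlinarith
      rw [abs_of_nonneg (Real.log_nonneg h1)]
      have := Real.log_le_sub_one_of_pos (x := t ^ 2) (by linarith)
      simp only [abs_zero]
      linarith

lemma integral_log_gaussian :
    ∫ t, Real.log (t ^ 2) ∂(gaussianReal 0 1) = (4 / Real.sqrt (2 * π)) *
          (∫ t in Set.Ioi (0 : ℝ), Real.log t * Real.exp (-t ^ 2 / 2)) := by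
  rw [integral_gaussianReal_eq_integral_smul one_ne_zero]
  have : ∀ x : ℝ, gaussianPDFReal 0 1 x • Real.log (x ^ 2)
      = (fun t => (2 / √(2 * π)) * (Real.log t * Real.exp (-t ^ 2 / 2))) |x| := by
    intro x
    simp [gaussianPDFReal, Real.log_pow]
    ring
  rw [integral_congr_ae (ae_of_all _ this),
    integral_comp_abs (f := fun t => (2 / √(2 * π)) * (Real.log t * Real.exp (-t ^ 2 / 2))),
    integral_const_mul]
  ring

lemma integral_sq_gaussian : ∫ t, t ^ 2 ∂(gaussianReal 0 1) = 1 := by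
  have h := variance_eq_sub (memLp_id_gaussianReal (μ := 0) (v := 1) 2)
  rw [variance_id_gaussianReal] at h
  simpa using h.symm

/-- If `q(x) = ⟨x, Qx⟩` is a positive semidefinite quadratic form with Gaussian
expectation `1`, then `C₀ ≤ E(ln q) ≤ 0` where
`C₀ = (4/√(2π)) ∫₀^∞ (ln t) e^{-t²/2} dt`. -/
theorem gaussian_expectation_log_quadratic_form {n : ℕ}
    (Q : Matrix (Fin n) (Fin n) ℝ) (hQ : Q.PosSemidef)
    (h1 : ∫ x : Fin n → ℝ, x ⬝ᵥ Q.mulVec x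
        ∂(Measure.pi fun _ : Fin n => gaussianReal 0 1) = 1) :
    Integrable (fun x : Fin n → ℝ => Real.log (x ⬝ᵥ Q.mulVec x))
        (Measure.pi fun _ : Fin n => gaussianReal 0 1) ∧
      (4 / Real.sqrt (2 * π)) *
          (∫ t in Set.Ioi (0 : ℝ), Real.log t * Real.exp (-t ^ 2 / 2)) ≤
        (∫ x : Fin n → ℝ, Real.log (x ⬝ᵥ Q.mulVec x)
          ∂(Measure.pi fun _ : Fin n => gaussianReal 0 1)) ∧
      (∫ x : Fin n → ℝ, Real.log (x ⬝ᵥ Q.mulVec x)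
          ∂(Measure.pi fun _ : Fin n => gaussianReal 0 1)) ≤ 0 := by
  obtain ⟨c, u, hc, hu, hq⟩ := psd_decomp Q hQ
  set P := Measure.pi fun _ : Fin n => gaussianReal 0 1 with hP
  have hmp : ∀ i, MeasurePreserving (fun x : Fin n → ℝ => ∑ j, u i j * x j) P
      (gaussianReal 0 1) := fun i => ⟨by fun_prop, map_unit (u i) (hu i)⟩
  have hsq : Integrable (fun t : ℝ => t ^ 2) (gaussianReal 0 1) :=
    (memLp_id_gaussianReal 2).integrable_sq
  have hsqi : ∀ i, Integrable (fun x : Fin n → ℝ => (∑ j, u i j * x j) ^ 2) P := fun i =>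
    (hmp i).integrable_comp_of_integrable hsq
  have hlogi : ∀ i, Integrable (fun x : Fin n → ℝ => Real.log ((∑ j, u i j * x j) ^ 2)) P :=
    fun i => (hmp i).integrable_comp_of_integrable integrable_log_gaussian
  have hsqv : ∀ i, ∫ x, (∑ j, u i j * x j) ^ 2 ∂P = 1 := fun i => by
    rw [← integral_sq_gaussian, ← (hmp i).map_eq,
      integral_map (hmp i).measurable.aemeasurable (by fun_prop)]
  have hlogv : ∀ i, ∫ x, Real.log ((∑ j, u i j * x j) ^ 2) ∂P =
      ∫ t, Real.log (t ^ 2) ∂(gaussianReal 0 1) := fun i => by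
    rw [← (hmp i).map_eq, integral_map (hmp i).measurable.aemeasurable]
    exact (Real.measurable_log.comp (measurable_id.pow_const 2)).aestronglyMeasurable
  have hne : ∀ᵐ x ∂P, ∀ i, (∑ j, u i j * x j) ≠ 0 := by
    rw [ae_all_iff]
    intro i
    have := nullSingletonClass_gaussianReal (μ := 0) (v := 1) one_ne_zero
    have : ∀ᵐ t ∂(gaussianReal 0 1), t ≠ 0 := by
      simp [ae_iff]
    exact (hmp i).quasiMeasurePreserving.ae this
  simp_rw [hq] at h1 ⊢
  have hqi : Integrable (fun x : Fin n → ℝ => ∑ i, c i * (∑ j, u i j * x j) ^ 2) P :=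
    integrable_finsetSum _ fun i _ => (hsqi i).const_mul _
  have hLi : Integrable (fun x : Fin n → ℝ => ∑ i, c i * Real.log ((∑ j, u i j * x j) ^ 2)) P :=
    integrable_finsetSum _ fun i _ => (hlogi i).const_mul _
  have hcs : ∑ i, c i = 1 := by
    rw [← h1, integral_finsetSum _ fun i _ => (hsqi i).const_mul _]
    simp_rw [integral_const_mul, hsqv, mul_one]
  have hLv : ∫ x, ∑ i, c i * Real.log ((∑ j, u i j * x j) ^ 2) ∂P =
      ∫ t, Real.log (t ^ 2) ∂(gaussianReal 0 1) := by
    rw [integral_finsetSum _ fun i _ => (hlogi i).const_mul _]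
    simp_rw [integral_const_mul, hlogv]
    rw [← Finset.sum_mul, hcs, one_mul]
  have hlow : ∀ᵐ x ∂P, ∑ i, c i * Real.log ((∑ j, u i j * x j) ^ 2) ≤
      Real.log (∑ i, c i * (∑ j, u i j * x j) ^ 2) := by
    filter_upwards [hne] with x hx
    have := strictConcaveOn_log_Ioi.concaveOn.le_map_sum (t := Finset.univ) (w := c)
      (p := fun i => (∑ j, u i j * x j) ^ 2) (fun i _ => hc i) hcs
      (fun i _ => by have := hx i; simp only [Set.mem_Ioi]; positivity)
    simpa using this
  have hup : ∀ᵐ x ∂P, Real.log (∑ i, c i * (∑ j, u i j * x j) ^ 2) ≤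
      (∑ i, c i * (∑ j, u i j * x j) ^ 2) - 1 := by
    filter_upwards [hne] with x hx
    apply Real.log_le_sub_one_of_pos
    obtain ⟨i, -, hi⟩ := Finset.exists_ne_zero_of_sum_ne_zero (hcs.trans_ne one_ne_zero)
    refine Finset.sum_pos' (fun i _ => mul_nonneg (hc i) (sq_nonneg _)) ⟨i, Finset.mem_univ i, ?_⟩
    have h2 := hx i
    have h3 := lt_of_le_of_ne (hc i) hi.symm
    positivity
  have hqi1 : Integrable (fun x : Fin n → ℝ => (∑ i, c i * (∑ j, u i j * x j) ^ 2) - 1) P :=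
    hqi.sub (integrable_const 1)
  have hint : Integrable (fun x : Fin n → ℝ =>
      Real.log (∑ i, c i * (∑ j, u i j * x j) ^ 2)) P := by
    refine (hLi.norm.add hqi1.norm).mono' ?_ ?_
    · exact (Real.measurable_log.comp (by fun_prop)).aestronglyMeasurable
    · filter_upwards [hlow, hup] with x h2 h3
      simp only [Pi.add_apply, Real.norm_eq_abs]
      rw [abs_le]
      constructor
      · have := neg_abs_le (∑ i, c i * Real.log ((∑ j, u i j * x j) ^ 2))
        have := abs_nonneg ((∑ i, c i * (∑ j, u i j * x j) ^ 2) - 1)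
        linarith
      · have := abs_nonneg (∑ i, c i * Real.log ((∑ j, u i j * x j) ^ 2))
        have := le_abs_self ((∑ i, c i * (∑ j, u i j * x j) ^ 2) - 1)
        linarith
  refine ⟨hint, ?_, ?_⟩
  · rw [← integral_log_gaussian, ← hLv]
    exact integral_mono_ae hLi hint hlow
  · refine (integral_mono_ae hint hqi1 hup).trans ?_
    rw [integral_sub hqi (integrable_const 1), h1]
    simp
end

section
/- Let q : R^n → R be a positive semidefinite quadratic form with E(q) = 1 under the standard Gaussian measure on R^n. Then 0 ≤ E(ln² q) ≤ 8. -/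
open MeasureTheory ProbabilityTheory Matrix Real

/-- truncated squared logarithm -/
noncomputable def gg (t : ℝ) : ℝ := (max (-Real.log t) 0) ^ 2

lemma gg_nonneg (t : ℝ) : 0 ≤ gg t := sq_nonneg _

lemma gg_measurable : Measurable gg := by unfold gg; fun_prop

lemma gg_convex : ConvexOn ℝ (Set.Ioi 0) gg := by
  have h1 : ConvexOn ℝ (Set.Ioi (0:ℝ)) (fun t => -Real.log t) :=
    strictConcaveOn_log_Ioi.concaveOn.neg
  have h2 : ConvexOn ℝ (Set.Ioi (0:ℝ)) (fun t => max (-Real.log t) 0) :=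
    h1.sup (convexOn_const 0 (convex_Ioi 0))
  exact h2.pow (fun x _ => le_max_right _ _) 2

lemma log_sq_le {t : ℝ} (ht : 0 < t) : Real.log t ^ 2 ≤ gg t + t := by
  unfold gg
  rcases le_total t 1 with h | h
  · have : Real.log t ≤ 0 := Real.log_nonpos ht.le h
    rw [max_eq_left (by linarith)]; nlinarith
  · have h0 : 0 ≤ Real.log t := Real.log_nonneg h
    have h3 : Real.log t = 2 * Real.log (√t) := by
      rw [Real.log_sqrt ht.le]; ring
    have hs : 0 < √t := Real.sqrt_pos.2 ht
    have hs2 : √t ^ 2 = t := Real.sq_sqrt ht.le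
    -- 2 log s ≤ s
    have h4 : 2 * Real.log (√t) ≤ √t := by
      have h5 := Real.log_le_sub_one_of_pos (show 0 < √t / 2 by positivity)
      rw [Real.log_div hs.ne' (by norm_num)] at h5
      have := Real.log_two_lt_d9
      linarith
    have : Real.log t ^ 2 ≤ √t ^ 2 := by
      rw [h3]; rw [h3] at h0; exact pow_le_pow_left₀ h0 h4 2
    have := sq_nonneg (max (-Real.log t) 0)
    linarith

lemma cont_aux : Continuous (fun x : ℝ => 4 * (√x * Real.log √x) ^ 2 - 2 * (x * Real.log x) + 2 * x) := by
  have h := Real.continuous_mul_log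
  have h2 : Continuous (fun x : ℝ => √x * Real.log √x) := h.comp Real.continuous_sqrt
  fun_prop

lemma deriv_aux (x : ℝ) (hx : x ∈ Set.Ioo (0:ℝ) 1) :
    HasDerivAt (fun x : ℝ => 4 * (√x * Real.log √x) ^ 2 - 2 * (x * Real.log x) + 2 * x)
      (Real.log x ^ 2) x := by
  have hx0 : x ≠ 0 := hx.1.ne'
  have h1 : HasDerivAt (fun x : ℝ => x * Real.log x ^ 2 - 2 * (x * Real.log x) + 2 * x)
      (Real.log x ^ 2) x := by
    have hl := Real.hasDerivAt_log hx0
    have hi := hasDerivAt_id x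
    convert! ((hi.mul (hl.pow 2)).sub ((hi.mul hl).const_mul 2)).add (hi.const_mul 2) using 1
    simp
    field_simp
    ring
  refine h1.congr_of_eventuallyEq ?_
  filter_upwards [eventually_gt_nhds hx.1] with y hy
  rw [Real.log_sqrt hy.le, mul_pow, Real.sq_sqrt hy.le]; ring

lemma logsq_integrableOn : IntegrableOn (fun x => Real.log x ^ 2) (Set.Ioc 0 1) :=
  intervalIntegral.integrableOn_deriv_of_nonneg cont_aux.continuousOn deriv_aux
    (fun _ _ => sq_nonneg _)

lemma logsq_integral : ∫ x in Set.Ioc (0:ℝ) 1, Real.log x ^ 2 = 2 := by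
  rw [← intervalIntegral.integral_of_le zero_le_one,
    intervalIntegral.integral_eq_sub_of_hasDerivAt_of_le zero_le_one cont_aux.continuousOn
    deriv_aux ((intervalIntegrable_iff_integrableOn_Ioc_of_le zero_le_one).2 logsq_integrableOn)]
  simp

/-- one-dimensional profile -/
lemma G_eq (x : ℝ) : gg (x ^ 2) = (Set.Ioc (0:ℝ) 1).indicator (fun x => 4 * Real.log x ^ 2) |x| := by
  have h : Real.log (x ^ 2) = 2 * Real.log |x| := by rw [Real.log_pow, Real.log_abs]; simp
  unfold gg
  rw [h, Set.indicator_apply]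
  split_ifs with h1
  · have := Real.log_nonpos h1.1.le h1.2
    rw [max_eq_left (by linarith)]; ring
  · rcases eq_or_ne x 0 with rfl | hx
    · simp
    · have : 1 < |x| := by
        by_contra hc
        exact h1 ⟨abs_pos.2 hx, not_lt.1 hc⟩
      have := Real.log_nonneg this.le
      rw [max_eq_right (by linarith)]; simp

lemma ind_integrable : Integrable ((Set.Ioc (0:ℝ) 1).indicator (fun x => 4 * Real.log x ^ 2)) :=
  (integrable_indicator_iff measurableSet_Ioc).2 (logsq_integrableOn.const_mul 4)

lemma G_integrable : Integrable (fun x : ℝ => gg (x ^ 2)) := by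
  simp_rw [G_eq]
  refine (ind_integrable.add ind_integrable.comp_neg).congr (ae_of_all _ fun x => ?_)
  simp only [Pi.add_apply]
  rcases le_total x 0 with h | h
  · rw [abs_of_nonpos h, Set.indicator_of_notMem (fun hx => absurd hx.1 (not_lt.2 h)), zero_add]
  · rw [abs_of_nonneg h, Set.indicator_of_notMem (a := -x)
      (fun hx => absurd hx.1 (not_lt.2 (by linarith))), add_zero]

lemma G_integral : ∫ x : ℝ, gg (x ^ 2) = 16 := by
  simp_rw [G_eq]
  rw [integral_comp_abs, setIntegral_indicator measurableSet_Ioc,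
    Set.inter_eq_right.2 Set.Ioc_subset_Ioi_self, integral_const_mul, logsq_integral]
  norm_num

lemma pdf_le (x : ℝ) : gaussianPDFReal 0 1 x ≤ 7 / 16 := by
  rw [gaussianPDFReal]
  have h1 : rexp (-(x - 0) ^ 2 / (2 * ((1 : NNReal) : ℝ))) ≤ 1 := by
    apply Real.exp_le_one_iff.2
    have := sq_nonneg x
    norm_num
    linarith
  have h2 : (√(2 * π * ((1 : NNReal) : ℝ)))⁻¹ ≤ 7 / 16 := by
    rw [inv_le_comm₀ (by simp; positivity) (by norm_num)]
    apply Real.le_sqrt_of_sq_le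
    have := Real.pi_gt_three
    norm_num; linarith
  calc _ ≤ (7 / 16 : ℝ) * 1 := by gcongr
    _ = _ := by norm_num

lemma G_integrable_gauss : Integrable (fun x : ℝ => gg (x ^ 2)) (gaussianReal 0 1) := by
  rw [gaussianReal_of_var_ne_zero _ one_ne_zero,
    integrable_withDensity_iff_integrable_smul₀' (by fun_prop) (ae_of_all _ fun _ => gaussianPDF_lt_top)]
  simp only [toReal_gaussianPDF, smul_eq_mul]
  refine (G_integrable.const_mul (7 / 16)).mono'
    ((measurable_gaussianPDFReal _ _).mul (gg_measurable.comp (by fun_prop))).aestronglyMeasurable ?_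
  refine ae_of_all _ fun x => ?_
  rw [Real.norm_of_nonneg (mul_nonneg (gaussianPDFReal_nonneg _ _ _) (gg_nonneg _))]
  exact mul_le_mul_of_nonneg_right (pdf_le x) (gg_nonneg _)

lemma G_integral_gauss : ∫ x : ℝ, gg (x ^ 2) ∂(gaussianReal 0 1) ≤ 7 := by
  rw [integral_gaussianReal_eq_integral_smul one_ne_zero]
  calc _ ≤ ∫ x : ℝ, (7 / 16) * gg (x ^ 2) := by
        refine integral_mono_of_nonneg (ae_of_all _ fun x => ?_) (G_integrable.const_mul _)
          (ae_of_all _ fun x => ?_)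
        · exact mul_nonneg (gaussianPDFReal_nonneg _ _ _) (gg_nonneg _)
        · exact mul_le_mul_of_nonneg_right (pdf_le x) (gg_nonneg _)
    _ = 7 := by rw [integral_const_mul, G_integral]; norm_num

lemma sq_integrable_gauss : Integrable (fun x : ℝ => x ^ 2) (gaussianReal 0 1) := by
  have := (memLp_id_gaussianReal (μ := 0) (v := 1) 2).integrable_sq
  simpa using this

lemma sq_integral_gauss : ∫ x : ℝ, x ^ 2 ∂(gaussianReal 0 1) = 1 := by
  have h := variance_fun_id_gaussianReal (μ := 0) (v := 1)
  rw [variance_of_integral_eq_zero (by fun_prop) integral_id_gaussianReal] at h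
  simpa using h

lemma law {n : ℕ} (v : EuclideanSpace ℝ (Fin n)) (hv : ‖v‖ = 1) :
    MeasurePreserving (fun x : Fin n → ℝ => x ⬝ᵥ v.ofLp)
      (Measure.pi fun _ : Fin n => gaussianReal 0 1) (gaussianReal 0 1) := by
  refine ⟨by unfold dotProduct; fun_prop, ?_⟩
  have e : (fun x : Fin n → ℝ => x ⬝ᵥ v.ofLp) = (innerSL ℝ v) ∘ (WithLp.toLp 2) := by
    ext x
    simp [EuclideanSpace.inner_eq_star_dotProduct]
  rw [e, ← Measure.map_map (by fun_prop) (by fun_prop), map_pi_eq_stdGaussian,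
    IsGaussian.map_eq_gaussianReal, integral_strongDual_stdGaussian, variance_dual_stdGaussian,
    innerSL_apply_norm, hv]
  simp

lemma quad {n : ℕ} (Q : Matrix (Fin n) (Fin n) ℝ) (hQ : Q.IsHermitian) (x : Fin n → ℝ) :
    x ⬝ᵥ Q.mulVec x = ∑ j, hQ.eigenvalues j * (x ⬝ᵥ (hQ.eigenvectorBasis j).ofLp) ^ 2 := by
  have h := hQ.eigenvectorBasis.sum_inner_mul_inner (WithLp.toLp 2 (Q.mulVec x)) (WithLp.toLp 2 x)
  simp only [EuclideanSpace.inner_eq_star_dotProduct, star_trivial] at h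
  rw [← h]
  refine Finset.sum_congr rfl fun j _ => ?_
  have h2 : (hQ.eigenvectorBasis j).ofLp ⬝ᵥ Q.mulVec x
      = hQ.eigenvalues j * (x ⬝ᵥ (hQ.eigenvectorBasis j).ofLp) := by
    have ht : Qᵀ = Q := by
      have h3 := hQ.eq
      rwa [Matrix.conjTranspose_eq_transpose_of_trivial] at h3
    rw [Matrix.dotProduct_mulVec, ← Matrix.mulVec_transpose, ht, hQ.mulVec_eigenvectorBasis,
      smul_dotProduct, dotProduct_comm, smul_eq_mul]
  rw [h2]; ring

theorem gaussian_expectation_log_sq_quadratic_form {n : ℕ}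
    (Q : Matrix (Fin n) (Fin n) ℝ) (hQ : Q.PosSemidef)
    (h1 : ∫ x : Fin n → ℝ, x ⬝ᵥ Q.mulVec x
        ∂(Measure.pi fun _ : Fin n => gaussianReal 0 1) = 1) :
    Integrable (fun x : Fin n → ℝ => (Real.log (x ⬝ᵥ Q.mulVec x)) ^ 2)
        (Measure.pi fun _ : Fin n => gaussianReal 0 1) ∧
      0 ≤ (∫ x : Fin n → ℝ, (Real.log (x ⬝ᵥ Q.mulVec x)) ^ 2
          ∂(Measure.pi fun _ : Fin n => gaussianReal 0 1)) ∧
      (∫ x : Fin n → ℝ, (Real.log (x ⬝ᵥ Q.mulVec x)) ^ 2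
          ∂(Measure.pi fun _ : Fin n => gaussianReal 0 1)) ≤ 8 := by
  have hH := hQ.isHermitian
  have hl0 : ∀ j, 0 ≤ hH.eigenvalues j := hQ.eigenvalues_nonneg
  simp only [quad Q hH] at h1 ⊢
  generalize hH.eigenvalues = l at *
  have hL : ∀ j, MeasurePreserving (fun x : Fin n → ℝ => x ⬝ᵥ (hH.eigenvectorBasis j).ofLp)
      (Measure.pi fun _ : Fin n => gaussianReal 0 1) (gaussianReal 0 1) :=
    fun j => law _ (hH.eigenvectorBasis.orthonormal.1 j)
  set y : Fin n → (Fin n → ℝ) → ℝ := fun j x => x ⬝ᵥ (hH.eigenvectorBasis j).ofLp with hy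
  set P := (Measure.pi fun _ : Fin n => gaussianReal 0 1) with hP
  change ∫ x, ∑ j, l j * (y j x) ^ 2 ∂P = 1 at h1
  change Integrable (fun x => Real.log (∑ j, l j * (y j x) ^ 2) ^ 2) P ∧
    0 ≤ ∫ x, Real.log (∑ j, l j * (y j x) ^ 2) ^ 2 ∂P ∧
    ∫ x, Real.log (∑ j, l j * (y j x) ^ 2) ^ 2 ∂P ≤ 8
  change ∀ j, MeasurePreserving (y j) P (gaussianReal 0 1) at hL
  clear_value y P
  have mi : ∀ (f : ℝ → ℝ), Measurable f → ∀ j,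
      ∫ x, f (y j x) ∂P = ∫ t, f t ∂(gaussianReal 0 1) := fun f hf j => by
    rw [← (hL j).map_eq, integral_map (hL j).measurable.aemeasurable hf.aestronglyMeasurable]
  have i2 : ∀ j, Integrable (fun x => (y j x) ^ 2) P := fun j =>
    (hL j).integrable_comp_of_integrable sq_integrable_gauss
  have ig : ∀ j, Integrable (fun x => gg ((y j x) ^ 2)) P := fun j =>
    (hL j).integrable_comp_of_integrable G_integrable_gauss
  have hmg : Measurable (fun t : ℝ => gg (t ^ 2)) := gg_measurable.comp (by fun_prop)
  have hsum : ∑ j, l j = 1 := by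
    rw [integral_finsetSum _ fun j _ => (i2 j).const_mul _] at h1
    rw [← h1]
    refine Finset.sum_congr rfl fun j _ => ?_
    rw [integral_const_mul, mi (fun t => t ^ 2) (by fun_prop), sq_integral_gauss, mul_one]
  have hne : ∀ᵐ x ∂P, ∀ j, y j x ≠ 0 := by
    rw [ae_all_iff]
    intro j
    have : NullSingletonClass (gaussianReal 0 1) := nullSingletonClass_gaussianReal one_ne_zero
    have h0 : ∀ᵐ t ∂(gaussianReal 0 1), t ≠ 0 := by simp [ae_iff]
    exact (hL j).quasiMeasurePreserving.ae h0
  have hbd : ∀ᵐ x ∂P, Real.log (∑ j, l j * (y j x) ^ 2) ^ 2 ≤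
      ∑ j, l j * gg ((y j x) ^ 2) + ∑ j, l j * (y j x) ^ 2 := by
    filter_upwards [hne] with x hx
    have hpos : ∀ j ∈ Finset.univ, (y j x) ^ 2 ∈ Set.Ioi (0:ℝ) := fun j _ => by
      have := hx j; simp only [Set.mem_Ioi]; positivity
    have hm := (convex_Ioi (0:ℝ)).sum_mem (fun j _ => hl0 j) hsum hpos
    have hc := gg_convex.map_sum_le (fun j _ => hl0 j) hsum hpos
    simp only [smul_eq_mul] at hm hc
    have := log_sq_le hm
    linarith
  have I1 : Integrable (fun x => ∑ j, l j * gg ((y j x) ^ 2)) P :=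
    integrable_finsetSum _ fun j _ => (ig j).const_mul _
  have I2 : Integrable (fun x => ∑ j, l j * (y j x) ^ 2) P :=
    integrable_finsetSum _ fun j _ => (i2 j).const_mul _
  have hym : ∀ j, Measurable (y j) := fun j => (hL j).measurable
  have hI : Integrable (fun x => Real.log (∑ j, l j * (y j x) ^ 2) ^ 2) P := by
    refine (I1.add I2).mono' (Measurable.aestronglyMeasurable (by fun_prop)) ?_
    filter_upwards [hbd] with x hx
    rw [Real.norm_of_nonneg (sq_nonneg _)]
    exact hx
  refine ⟨hI, integral_nonneg fun x => sq_nonneg _, ?_⟩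
  calc _ ≤ ∫ x, (∑ j, l j * gg ((y j x) ^ 2) + ∑ j, l j * (y j x) ^ 2) ∂P :=
        integral_mono_ae hI (I1.add I2) hbd
    _ = ∑ j, l j * ∫ t, gg (t ^ 2) ∂(gaussianReal 0 1) + 1 := by
        rw [integral_add I1 I2, h1, integral_finsetSum _ fun j _ => (ig j).const_mul _]
        congr 1
        refine Finset.sum_congr rfl fun j _ => ?_
        rw [integral_const_mul, mi _ hmg]
    _ ≤ 8 := by
        rw [← Finset.sum_mul, hsum]
        linarith [G_integral_gauss]
end
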